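/- For every finite group G, the limit as n → ∞ of α(Gⁿ) equals 1/φ(exp(G)), where Gⁿ denotes the direct product of n copies of G. -/

import Mathlib

open scoped Classical

/-- The number of cyclic subgroups of a group. -/
noncomputable def numCyclic (G : Type*) [Group G] : ℕ :=
  Nat.card {H : Subgroup G // IsCyclic (↥H)}

/-- `alpha G = c(G) / |G|`, the number of cyclic subgroups divided by the order. -/
noncomputable def alpha (G : Type*) [Group G] : ℚ :=
  (numCyclic G : ℚ) / (Nat.card G : ℚ)

/-- A cyclic subgroup of order `m` has exactly `φ(m)` generators. -/
theorem card_filter_zpowers_eq {H : Type*} [Group H] [Fintype H] (C : Subgroup H)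
    [IsCyclic C] :
    (Finset.univ.filter fun x : H => Subgroup.zpowers x = C).card =
      Nat.totient (Nat.card C) := by
  have h := IsCyclic.card_orderOf_eq_totient (α := C) (d := Fintype.card C) dvd_rfl
  rw [Nat.card_eq_fintype_card, ← h]
  symm
  refine Finset.card_bij (fun y _ => (y : H)) ?_ ?_ ?_
  · intro y hy
    simp only [Finset.mem_filter, Finset.mem_univ, true_and] at hy ⊢
    refine Subgroup.eq_of_le_of_card_ge ?_ ?_
    · exact Subgroup.zpowers_le.mpr y.2
    · rw [Nat.card_zpowers, Subgroup.orderOf_coe, hy, Nat.card_eq_fintype_card]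
  · intro a _ b _ hab
    exact Subtype.ext hab
  · intro x hx
    simp only [Finset.mem_filter, Finset.mem_univ, true_and] at hx
    subst hx
    refine ⟨⟨x, Subgroup.mem_zpowers x⟩, ?_, rfl⟩
    simp only [Finset.mem_filter, Finset.mem_univ, true_and]
    rw [← Nat.card_eq_fintype_card, Nat.card_zpowers, ← Subgroup.orderOf_coe]

/-- The number of cyclic subgroups is the sum of `1 / φ(o(x))` over all elements `x`. -/
theorem numCyclic_eq_sum (H : Type*) [Group H] [Fintype H] :
    (numCyclic H : ℝ) = ∑ x : H, (1 / (Nat.totient (orderOf x) : ℝ)) := by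
  have hmaps : ∀ x ∈ (Finset.univ : Finset H), Subgroup.zpowers x ∈
      Finset.univ.filter fun C : Subgroup H => IsCyclic C := by
    intro x _
    simp only [Finset.mem_filter, Finset.mem_univ, true_and]
    infer_instance
  rw [← Finset.sum_fiberwise_of_maps_to hmaps]
  have hfiber : ∀ C ∈ Finset.univ.filter fun C : Subgroup H => IsCyclic C,
      ∑ x : H with Subgroup.zpowers x = C, (1 / (Nat.totient (orderOf x) : ℝ)) = 1 := by
    intro C hC
    simp only [Finset.mem_filter, Finset.mem_univ, true_and] at hC
    have hconst : ∀ x ∈ Finset.univ.filter fun x : H => Subgroup.zpowers x = C,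
        (1 / (Nat.totient (orderOf x) : ℝ)) = 1 / (Nat.totient (Nat.card C) : ℝ) := by
      intro x hx
      simp only [Finset.mem_filter, Finset.mem_univ, true_and] at hx
      rw [← hx, Nat.card_zpowers]
    rw [Finset.sum_congr rfl hconst, Finset.sum_const, card_filter_zpowers_eq, nsmul_eq_mul]
    have hpos : 0 < Nat.totient (Nat.card C) := Nat.totient_pos.mpr Nat.card_pos
    field_simp
  rw [Finset.sum_congr rfl hfiber, Finset.sum_const, nsmul_eq_mul, mul_one, numCyclic,
    Nat.card_eq_fintype_card, Fintype.card_subtype]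

theorem orderOf_pi_dvd_exponent {G : Type*} [Group G] {ι : Type*} (x : ι → G) :
    orderOf x ∣ Monoid.exponent G :=
  orderOf_dvd_of_pow_eq_one (funext fun i => Monoid.pow_exponent_eq_one (x i))

/-- A tuple whose coordinates exhaust `G` has order equal to the exponent of `G`. -/
theorem orderOf_eq_exponent_of_surjective {G : Type*} [Group G] {ι : Type*} {x : ι → G}
    (hx : Function.Surjective x) : orderOf x = Monoid.exponent G := by
  refine Nat.dvd_antisymm (orderOf_pi_dvd_exponent x) ?_
  refine Monoid.exponent_dvd_of_forall_pow_eq_one fun g => ?_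
  obtain ⟨i, rfl⟩ := hx g
  exact congrFun (pow_orderOf_eq_one x) i

theorem card_filter_not_surjective_le (G : Type*) [Fintype G] (n : ℕ) :
    (Finset.univ.filter fun x : Fin n → G => ¬ Function.Surjective x).card ≤
      Fintype.card G * (Fintype.card G - 1) ^ n := by
  have hsub : (Finset.univ.filter fun x : Fin n → G => ¬ Function.Surjective x) ⊆
      Finset.univ.biUnion fun g : G =>
        Fintype.piFinset fun _ : Fin n => Finset.univ.erase g := by
    intro x hx
    simpa [Function.Surjective] using hx
  refine (Finset.card_le_card hsub).trans (Finset.card_biUnion_le.trans ?_)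
  simp [Fintype.card_piFinset, Finset.card_erase_of_mem]

/-- The distance of `α(Gⁿ)` from `1 / φ(exp G)` is at most the proportion of tuples
that do not exhaust `G`. -/
theorem abs_alpha_pi_sub_le (G : Type*) [Group G] [Fintype G] (n : ℕ) :
    |((alpha (Fin n → G) : ℚ) : ℝ) - 1 / (Nat.totient (Monoid.exponent G) : ℝ)| ≤
      Fintype.card G * (((Fintype.card G - 1 : ℕ) : ℝ) / Fintype.card G) ^ n := by
  set e := Monoid.exponent G with he
  set N := Fintype.card G with hN
  have hNpos : (0 : ℝ) < N := by exact_mod_cast Fintype.card_pos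
  have hNn : (0 : ℝ) < (N : ℝ) ^ n := pow_pos hNpos n
  have hterm : ∀ x : Fin n → G,
      |1 / (Nat.totient (orderOf x) : ℝ) - 1 / (Nat.totient e : ℝ)| ≤
        if ¬ Function.Surjective x then 1 else 0 := by
    intro x
    split_ifs with h
    · rw [orderOf_eq_exponent_of_surjective h]
      simp [he]
    · have h1 : (1 : ℝ) ≤ Nat.totient (orderOf x) := by
        exact_mod_cast Nat.totient_pos.mpr (orderOf_pos x)
      have h2 : (1 : ℝ) ≤ Nat.totient e := by
        exact_mod_cast Nat.totient_pos.mpr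
          (Nat.pos_of_ne_zero Monoid.exponent_ne_zero_of_finite)
      have h3 := (div_le_one (zero_lt_one.trans_le h1)).mpr h1
      have h4 := (div_le_one (zero_lt_one.trans_le h2)).mpr h2
      have h5 : (0 : ℝ) ≤ 1 / Nat.totient (orderOf x) := by positivity
      have h6 : (0 : ℝ) ≤ 1 / Nat.totient e := by positivity
      rw [abs_le]
      constructor <;> linarith
  have hcard : (Nat.card (Fin n → G) : ℝ) = (N : ℝ) ^ n := by
    simp [hN]
  have hrw : ((alpha (Fin n → G) : ℚ) : ℝ) - 1 / (Nat.totient e : ℝ) =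
      (∑ x : Fin n → G, (1 / (Nat.totient (orderOf x) : ℝ) - 1 / (Nat.totient e : ℝ))) /
        (N : ℝ) ^ n := by
    rw [alpha, Rat.cast_div, Rat.cast_natCast, Rat.cast_natCast, numCyclic_eq_sum, hcard,
      Finset.sum_sub_distrib, Finset.sum_const, Finset.card_univ, ← Nat.card_eq_fintype_card,
      nsmul_eq_mul, hcard, sub_div, mul_div_cancel_left₀ _ hNn.ne']
  rw [hrw, abs_div, abs_of_pos hNn, div_pow, ← mul_div_assoc]
  gcongr
  calc _ ≤ ∑ x : Fin n → G,
        |1 / (Nat.totient (orderOf x) : ℝ) - 1 / (Nat.totient e : ℝ)| :=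
        Finset.abs_sum_le_sum_abs _ _
    _ ≤ ∑ x : Fin n → G, if ¬ Function.Surjective x then (1 : ℝ) else 0 :=
        Finset.sum_le_sum fun x _ => hterm x
    _ = (Finset.univ.filter fun x : Fin n → G => ¬ Function.Surjective x).card := by
        rw [Finset.sum_boole]
    _ ≤ _ := by exact_mod_cast card_filter_not_surjective_le G n

theorem stmt_11 (G : Type*) [Group G] [Fintype G] :
    Filter.Tendsto (fun n : ℕ => ((alpha (Fin n → G) : ℚ) : ℝ))
      Filter.atTop (nhds (1 / (Nat.totient (Monoid.exponent G) : ℝ))) := by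
  have hpos : 0 < Fintype.card G := Fintype.card_pos
  have hlt : ((Fintype.card G - 1 : ℕ) : ℝ) / Fintype.card G < 1 := by
    rw [div_lt_one (by exact_mod_cast hpos)]
    exact_mod_cast Nat.sub_lt hpos one_pos
  have hlim := (tendsto_pow_atTop_nhds_zero_of_lt_one (by positivity) hlt).const_mul
    (Fintype.card G : ℝ)
  rw [mul_zero] at hlim
  rw [tendsto_iff_dist_tendsto_zero]
  exact squeeze_zero (fun _ => dist_nonneg) (fun n => abs_alpha_pi_sub_le G n) hlim
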